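/- (Prieß-Crampe fixed-point theorem) Let (M,d) be a non-empty spherically complete ultrametric space. Then every strictly contractive mapping f : M → M has a unique fixed point. -/

import Mathlib

inductive Formula : Type
  | atom : ℕ → Formula
  | bot  : Formula
  | imp  : Formula → Formula → Formula
  | box  : Formula → Formula
deriving DecidableEq

def boxtimes (Γ : Multiset Formula) : Multiset Formula := Γ + Γ.map Formula.box

inductive GoSeq : Bool → Multiset Formula → Multiset Formula → Prop
  | ax (c) (Γ Δ : Multiset Formula) (A : Formula) : GoSeq c (A ::ₘ Γ) (A ::ₘ Δ)
  | axBot (c) (Γ Δ : Multiset Formula) : GoSeq c (Formula.bot ::ₘ Γ) Δ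
  | impL (c) (Γ Δ : Multiset Formula) (A B : Formula) :
      GoSeq c (B ::ₘ Γ) Δ → GoSeq c Γ (A ::ₘ Δ) → GoSeq c ((A.imp B) ::ₘ Γ) Δ
  | impR (c) (Γ Δ : Multiset Formula) (A B : Formula) :
      GoSeq c (A ::ₘ Γ) (B ::ₘ Δ) → GoSeq c Γ ((A.imp B) ::ₘ Δ)
  | boxGo (c) (Γ Δ Θ : Multiset Formula) (A : Formula) :
      GoSeq c ((Formula.box (A.imp (Formula.box A))) ::ₘ boxtimes Θ) {A} →
      GoSeq c (Γ + Θ.map Formula.box) ((Formula.box A) ::ₘ Δ)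
  | cut (Γ Δ : Multiset Formula) (A : Formula) :
      GoSeq true Γ (A ::ₘ Δ) → GoSeq true (A ::ₘ Γ) Δ → GoSeq true Γ Δ

inductive Frag : Bool → ℕ → Multiset Formula → Multiset Formula → Type
  | hole (c) (Γ Δ : Multiset Formula) : Frag c 0 Γ Δ
  | axP (c) (n) (Γ Δ : Multiset Formula) (p : ℕ) :
      Frag c (n+1) (Formula.atom p ::ₘ Γ) (Formula.atom p ::ₘ Δ)
  | axBot (c) (n) (Γ Δ : Multiset Formula) : Frag c (n+1) (Formula.bot ::ₘ Γ) Δ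
  | impL (c) (n) (Γ Δ : Multiset Formula) (A B : Formula) :
      Frag c (n+1) (B ::ₘ Γ) Δ → Frag c (n+1) Γ (A ::ₘ Δ) →
      Frag c (n+1) ((A.imp B) ::ₘ Γ) Δ
  | impR (c) (n) (Γ Δ : Multiset Formula) (A B : Formula) :
      Frag c (n+1) (A ::ₘ Γ) (B ::ₘ Δ) → Frag c (n+1) Γ ((A.imp B) ::ₘ Δ)
  | box (c) (n) (Γ Δ Θ : Multiset Formula) (l : List Formula) (h : l ≠ []) :
      Frag c (n+1) (boxtimes Θ) (boxtimes (↑l)) →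
      ((i : Fin l.length) → Frag c n (boxtimes Θ) {l.get i}) →
      Frag c (n+1) (Γ + Θ.map Formula.box) ((↑(l.map Formula.box) : Multiset Formula) + Δ)
  | cut (n) (Γ Δ : Multiset Formula) (A : Formula) :
      Frag true (n+1) Γ (A ::ₘ Δ) → Frag true (n+1) (A ::ₘ Γ) Δ → Frag true (n+1) Γ Δ

def Frag.trunc : ∀ {c : Bool} {n : ℕ} {Γ Δ : Multiset Formula}, Frag c (n+1) Γ Δ → Frag c n Γ Δ
  | c, 0, Γ, Δ, _ => .hole c Γ Δ
  | c, n+1, _, _, .axP _ _ Γ Δ p => .axP c n Γ Δ p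
  | c, n+1, _, _, .axBot _ _ Γ Δ => .axBot c n Γ Δ
  | c, n+1, _, _, .impL _ _ Γ Δ A B a b => .impL c n Γ Δ A B a.trunc b.trunc
  | c, n+1, _, _, .impR _ _ Γ Δ A B a => .impR c n Γ Δ A B a.trunc
  | c, n+1, _, _, .box _ _ Γ Δ Θ l h a bs => .box c n Γ Δ Θ l h a.trunc (fun i => (bs i).trunc)
  | _, n+1, _, _, .cut _ Γ Δ A a b => .cut n Γ Δ A a.trunc b.trunc

def Frag.height : ∀ {c : Bool} {n : ℕ} {Γ Δ : Multiset Formula}, Frag c n Γ Δ → ℕ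
  | _, _, _, _, .hole _ _ _ => 0
  | _, _, _, _, .axP _ _ _ _ _ => 0
  | _, _, _, _, .axBot _ _ _ _ => 0
  | _, _, _, _, .impL _ _ _ _ _ _ a b => max a.height b.height + 1
  | _, _, _, _, .impR _ _ _ _ _ _ a => a.height + 1
  | _, _, _, _, .box _ _ _ _ _ _ _ a bs =>
      max a.height (Finset.univ.sup fun i => (bs i).height) + 1
  | _, _, _, _, .cut _ _ _ _ a b => max a.height b.height + 1

def Frag.cutFree : ∀ {c : Bool} {n : ℕ} {Γ Δ : Multiset Formula}, Frag c n Γ Δ → Prop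
  | _, _, _, _, .hole _ _ _ => True
  | _, _, _, _, .axP _ _ _ _ _ => True
  | _, _, _, _, .axBot _ _ _ _ => True
  | _, _, _, _, .impL _ _ _ _ _ _ a b => a.cutFree ∧ b.cutFree
  | _, _, _, _, .impR _ _ _ _ _ _ a => a.cutFree
  | _, _, _, _, .box _ _ _ _ _ _ _ a bs => a.cutFree ∧ ∀ i, (bs i).cutFree
  | _, _, _, _, .cut _ _ _ _ _ _ => False

structure InfProof (c : Bool) (Γ Δ : Multiset Formula) : Type where
  frag : ∀ n : ℕ, Frag c n Γ Δ
  compat : ∀ n : ℕ, (frag (n+1)).trunc = frag n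

structure PP : Type where
  Γ : Multiset Formula
  Δ : Multiset Formula
  prf : InfProof true Γ Δ

def Sim : ℕ → PP → PP → Prop
  | 0, _, _ => True
  | n+1, π, τ => π.Γ = τ.Γ ∧ π.Δ = τ.Δ ∧ HEq (π.prf.frag (n+1)) (τ.prf.frag (n+1))

noncomputable def dP (π τ : PP) : ℝ :=
  sInf {r : ℝ | ∃ n : ℕ, Sim n π τ ∧ r = (1/2 : ℝ) ^ n}

def localHeight (π : PP) : ℕ := (π.prf.frag 1).height

def Pmem (n : ℕ) (π : PP) : Prop := (π.prf.frag n).cutFree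

def IsUltrametric {M : Type*} (d : M → M → ℝ) : Prop :=
  (∀ x y, 0 ≤ d x y) ∧ (∀ x y, d x y = 0 ↔ x = y) ∧ (∀ x y, d x y = d y x) ∧
  (∀ x y z, d x z ≤ max (d x y) (d y z))

def cBall {M : Type*} (d : M → M → ℝ) (x : M) (r : ℝ) : Set M := {y | d x y ≤ r}

def SphericallyComplete {M : Type*} (d : M → M → ℝ) : Prop :=
  ∀ (c : ℕ → M) (r : ℕ → ℝ), (∀ n, 0 ≤ r n) →
    (∀ n, cBall d (c (n+1)) (r (n+1)) ⊆ cBall d (c n) (r n)) →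
    ∃ x, ∀ n, x ∈ cBall d (c n) (r n)

def NonExpansive1 (u : PP → PP) : Prop := ∀ π τ, dP (u π) (u τ) ≤ dP π τ

def Adequate1 (u : PP → PP) : Prop := ∀ n π, Pmem n π → Pmem n (u π)

noncomputable def dPm {m : ℕ} (x y : Fin m → PP) : ℝ := ⨆ i, dP (x i) (y i)

def NonExpansiveM {m : ℕ} (u : (Fin m → PP) → PP) : Prop :=
  ∀ x y, dP (u x) (u y) ≤ dPm x y

def Fm (m : ℕ) : Type := {u : (Fin m → PP) → PP // NonExpansiveM u}

def SimF {m : ℕ} (n k : ℕ) (a b : (Fin m → PP) → PP) : Prop :=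
  (∀ x, Sim n (a x) (b x)) ∧
  (∀ x, (∑ i, localHeight (x i)) < k → Sim (n+1) (a x) (b x))

noncomputable def lm {m : ℕ} (a b : (Fin m → PP) → PP) : ℝ :=
  (1/2) * sInf {r : ℝ | ∃ n k : ℕ, SimF n k a b ∧ r = (1/2 : ℝ) ^ n + (1/2 : ℝ) ^ (n + k)}

noncomputable def dP2 (p q : PP × PP) : ℝ := max (dP p.1 q.1) (dP p.2 q.2)

def NonExpansive2 (u : PP × PP → PP) : Prop := ∀ p q, dP (u p) (u q) ≤ dP2 p q

def Adequate2 (u : PP × PP → PP) : Prop :=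
  ∀ n π τ, Pmem n π → Pmem n τ → Pmem n (u (π, τ))

def Removing (A : Formula) (u : PP × PP → PP) : Prop :=
  ∀ (Γ Δ : Multiset Formula) (π τ : PP),
    π.Γ = Γ → π.Δ = A ::ₘ Δ → τ.Γ = A ::ₘ Γ → τ.Δ = Δ →
    (u (π, τ)).Γ = Γ ∧ (u (π, τ)).Δ = Δ

def RA (A : Formula) : Type := {u : PP × PP → PP // NonExpansive2 u ∧ Removing A u}

def SimF2 (n k : ℕ) (a b : PP × PP → PP) : Prop :=
  (∀ p, Sim n (a p) (b p)) ∧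
  (∀ p : PP × PP, localHeight p.1 + localHeight p.2 < k → Sim (n+1) (a p) (b p))

noncomputable def l2 (a b : PP × PP → PP) : ℝ :=
  (1/2) * sInf {r : ℝ | ∃ n k : ℕ, SimF2 n k a b ∧ r = (1/2 : ℝ) ^ n + (1/2 : ℝ) ^ (n + k)}

section FixedPoint

variable {M : Type*} {d : M → M → ℝ} {f : M → M}

/-- A map that does not increase distances does not increase `d x (f x)` inside the ball
of radius `d x (f x)` around `x`. -/
lemma IsUltrametric.displacement_le (hu : IsUltrametric d) (hf : ∀ x y, d (f x) (f y) ≤ d x y)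
    {x y : M} (hxy : d x y ≤ d x (f x)) : d y (f y) ≤ d x (f x) := by
  obtain ⟨-, -, hsymm, htri⟩ := hu
  refine (htri y x (f y)).trans (max_le ((hsymm y x).trans_le hxy) ?_)
  exact (htri x (f x) (f y)).trans (max_le le_rfl ((hf x y).trans hxy))

/-- A nonnegative function is almost minimized over any set with a point. -/
lemma exists_mem_forall_lt_add {g : M → ℝ} (hg : ∀ x, 0 ≤ g x) {s : Set M} (hs : s.Nonempty)
    {ε : ℝ} (hε : 0 < ε) : ∃ y ∈ s, ∀ z ∈ s, g y < g z + ε := by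
  have hbdd : BddBelow (g '' s) := ⟨0, by rintro _ ⟨x, -, rfl⟩; exact hg x⟩
  obtain ⟨_, ⟨y, hy, rfl⟩, hlt⟩ := exists_lt_of_csInf_lt (hs.image g)
    (lt_add_of_pos_right (sInf (g '' s)) hε)
  refine ⟨y, hy, fun z hz => hlt.trans_le ?_⟩
  gcongr
  exact csInf_le hbdd ⟨z, hz, rfl⟩

/-- In a spherically complete ultrametric space, some ball of radius `d x (f x)` around `x`
contains no point that is displaced less than `x`. -/
lemma SphericallyComplete.exists_minimal_displacement [Nonempty M] (hu : IsUltrametric d)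
    (hs : SphericallyComplete d) (hf : ∀ x y, d (f x) (f y) ≤ d x y) :
    ∃ x, ∀ y, d x y ≤ d x (f x) → d x (f x) ≤ d y (f y) := by
  have hmono {x y : M} (h : d x y ≤ d x (f x)) := hu.displacement_le hf h
  obtain ⟨hnonneg, -, -, htri⟩ := hu
  have htrans {x y z : M} (hxy : d x y ≤ d x (f x)) (hyz : d y z ≤ d y (f y)) :
      d x z ≤ d x (f x) :=
    (htri x y z).trans (max_le hxy (hyz.trans (hmono hxy)))
  have hstep (n : ℕ) (x : M) : ∃ y ∈ cBall d x (d x (f x)), ∀ z ∈ cBall d x (d x (f x)),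
      d y (f y) < d z (f z) + 1 / ((n : ℝ) + 1) :=
    exists_mem_forall_lt_add (g := fun x => d x (f x)) (fun x => hnonneg x (f x))
      ⟨f x, le_refl (d x (f x))⟩ Nat.one_div_pos_of_nat
  choose next hnext hmin using hstep
  let c : ℕ → M := Nat.rec (Classical.arbitrary M) next
  obtain ⟨x, hx⟩ := hs c (fun n => d (c n) (f (c n))) (fun n => hnonneg _ _)
    (fun n y hy => htrans (hnext n (c n)) hy)
  refine ⟨x, fun y hy => le_of_forall_pos_lt_add fun ε hε => ?_⟩
  obtain ⟨n, hn⟩ := exists_nat_one_div_lt hε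
  calc d x (f x) ≤ d (c (n + 1)) (f (c (n + 1))) := hmono (hx (n + 1))
    _ < d y (f y) + 1 / ((n : ℝ) + 1) := hmin n (c n) y (htrans (hx n) hy)
    _ < d y (f y) + ε := by gcongr

end FixedPoint

theorem stmt11 {M : Type*} [Nonempty M] (d : M → M → ℝ)
    (hu : IsUltrametric d) (hs : SphericallyComplete d)
    (f : M → M) (hf : ∀ x y, x ≠ y → d (f x) (f y) < d x y) :
    ∃! x, f x = x := by
  have hle (x y : M) : d (f x) (f y) ≤ d x y := by
    rcases eq_or_ne x y with rfl | hxy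
    · rw [(hu.2.1 _ _).2 rfl]
      exact hu.1 x x
    · exact (hf x y hxy).le
  obtain ⟨x, hx⟩ := hs.exists_minimal_displacement hu hle
  have hfix : f x = x := by
    by_contra hne
    exact (hx (f x) le_rfl).not_gt (hf x (f x) (Ne.symm hne))
  refine ⟨x, hfix, fun y hy => ?_⟩
  by_contra hne
  have hlt := hf y x hne
  rw [hy, hfix] at hlt
  exact hlt.false
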